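/- arXiv:1502.04332 — 3 statements merged into one kernel-verified Lean document; each statement's English description precedes it below -/
import Mathlib

section
/- Let n ≥ 2 be an integer and p a prime. The double coset Λ_n D^(n)(p) Λ_n is the disjoint union of the right cosets Λ_n C as C ranges over R₀^(n)(p) ∪ R₁^(n)(p); that is, every element of Λ_n D^(n)(p) Λ_n lies in Λ_n C for exactly one C ∈ R₀^(n)(p) ∪ R₁^(n)(p), the sets R₀^(n)(p) and R₁^(n)(p) are disjoint, and distinct matrices in R₀^(n)(p) ∪ R₁^(n)(p) lie in distinct right cosets Λ_n C. -/
open Matrix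

/-- `Λ_n = GL_n(ℤ)` viewed inside the `n × n` rational matrices: the matrices with integer
entries whose determinant is `±1`. -/
def Lambda (n : ℕ) : Set (Matrix (Fin n) (Fin n) ℚ) :=
  {γ | (∀ i j, ∃ z : ℤ, γ i j = (z : ℚ)) ∧ (γ.det = 1 ∨ γ.det = -1)}

/-- The right coset `Λ_n h = {γ * h : γ ∈ Λ_n}`. -/
def rightCoset (n : ℕ) (h : Matrix (Fin n) (Fin n) ℚ) : Set (Matrix (Fin n) (Fin n) ℚ) :=
  {m | ∃ γ ∈ Lambda n, m = γ * h}

/-- The double coset `Λ_n g Λ_n = {γ₁ * g * γ₂ : γ₁, γ₂ ∈ Λ_n}`. -/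
def doubleCoset (n : ℕ) (g : Matrix (Fin n) (Fin n) ℚ) : Set (Matrix (Fin n) (Fin n) ℚ) :=
  {m | ∃ γ₁ ∈ Lambda n, ∃ γ₂ ∈ Lambda n, m = γ₁ * g * γ₂}

/-- The degree of `g`: the number of distinct right cosets `Λ_n h` contained in `Λ_n g Λ_n`. -/
noncomputable def degree (n : ℕ) (g : Matrix (Fin n) (Fin n) ℚ) : ℕ :=
  Set.ncard {S : Set (Matrix (Fin n) (Fin n) ℚ) | ∃ h ∈ doubleCoset n g, S = rightCoset n h}

/-- The `k`-th determinantal divisor of an `n × n` integer matrix: the gcd of all of its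
`k × k` minors (which is `0` when all these minors vanish), a minor being indexed by a pair
of strictly increasing maps `Fin k → Fin n` selecting rows and columns. -/
def detDiv (n k : ℕ) (C : Matrix (Fin n) (Fin n) ℤ) : ℤ :=
  Finset.gcd ((Finset.univ : Finset ((Fin k → Fin n) × (Fin k → Fin n))).filter
      (fun fg => (∀ a b : Fin k, a < b → fg.1 a < fg.1 b) ∧
        (∀ a b : Fin k, a < b → fg.2 a < fg.2 b)))
    (fun fg => (C.submatrix fg.1 fg.2).det)

/-- `D^(n)(p) = diag(1, p, …, p, p²)` with `n - 2` middle diagonal entries equal to `p`. -/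
def Dmat (n p : ℕ) : Matrix (Fin n) (Fin n) ℤ :=
  Matrix.diagonal (fun i => if i.val = 0 then 1 else if i.val = n - 1 then (p : ℤ) ^ 2 else (p : ℤ))

/-- The set `R₀^(n)(p)` of upper-triangular integer matrices whose determinantal divisors are
`d_k = p^(k-1)` for `1 ≤ k ≤ n - 1` and `d_n = p^n`, whose diagonal entries all equal `p`, and
whose above-diagonal entries lie in `[0, p)`. -/
def R0 (n p : ℕ) : Set (Matrix (Fin n) (Fin n) ℤ) :=
  {C | (∀ i j : Fin n, j < i → C i j = 0) ∧
    (∀ k : ℕ, 1 ≤ k → k ≤ n - 1 → detDiv n k C = (p : ℤ) ^ (k - 1)) ∧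
    detDiv n n C = (p : ℤ) ^ n ∧
    (∀ i : Fin n, C i i = (p : ℤ)) ∧
    (∀ i j : Fin n, i < j → 0 ≤ C i j ∧ C i j < (p : ℤ))}

/-- The set `R₁^(n)(p)` of upper-triangular integer matrices whose diagonal entries lie in
`{1, p, p²}` with exactly one entry `1` and exactly one entry `p²`, whose above-diagonal
entries satisfy `0 ≤ c i j < c j j`, and such that `p ∣ c i i` implies `p ∣ c i j` for `j > i`. -/
def R1 (n p : ℕ) : Set (Matrix (Fin n) (Fin n) ℤ) :=
  {C | (∀ i j : Fin n, j < i → C i j = 0) ∧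
    (∀ i : Fin n, C i i = 1 ∨ C i i = (p : ℤ) ∨ C i i = (p : ℤ) ^ 2) ∧
    (∃! i : Fin n, C i i = 1) ∧
    (∃! i : Fin n, C i i = (p : ℤ) ^ 2) ∧
    (∀ i j : Fin n, i < j → 0 ≤ C i j ∧ C i j < C j j) ∧
    (∀ i j : Fin n, i < j → (p : ℤ) ∣ C i i → (p : ℤ) ∣ C i j)}

/-- Casting an integer matrix to a rational matrix. -/
def toQ (n : ℕ) (C : Matrix (Fin n) (Fin n) ℤ) : Matrix (Fin n) (Fin n) ℚ :=
  C.map (fun z : ℤ => (z : ℚ))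

/-- If `d` divides all `k × k` minors of `M`, it divides those of `A * M`. -/
lemma dvd_minors_mul_left {n k : ℕ} {d : ℤ} {A M : Matrix (Fin n) (Fin n) ℤ}
    (h : ∀ f g : Fin k → Fin n, d ∣ (M.submatrix f g).det) (f g : Fin k → Fin n) :
    d ∣ ((A * M).submatrix f g).det := by
  have key : ((A * M).submatrix f g).det =
      ∑ r : Fin k → Fin n, (∏ i, A (f i) (r i)) * (M.submatrix r g).det := by
    have hrow : (A * M).submatrix f g =
        fun i => ∑ l, A (f i) l • fun j => M l (g j) := by
      ext i j
      simp [Matrix.mul_apply]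
    rw [hrow]
    change (Matrix.detRowAlternating (R := ℤ)).toMultilinearMap _ = _
    rw [MultilinearMap.map_sum]
    refine Finset.sum_congr rfl fun r _ => ?_
    rw [MultilinearMap.map_smul_univ]
    rfl
  rw [key]
  exact Finset.dvd_sum fun r _ => (h r g).mul_left _

lemma dvd_minors_mul_right {n k : ℕ} {d : ℤ} {M B : Matrix (Fin n) (Fin n) ℤ}
    (h : ∀ f g : Fin k → Fin n, d ∣ (M.submatrix f g).det) (f g : Fin k → Fin n) :
    d ∣ ((M * B).submatrix f g).det := by
  have h' : ∀ f g : Fin k → Fin n, d ∣ (Mᵀ.submatrix f g).det := fun f g => by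
    rw [← Matrix.transpose_submatrix, Matrix.det_transpose]
    exact h g f
  have := dvd_minors_mul_left (A := Bᵀ) h' g f
  rwa [← Matrix.transpose_mul, ← Matrix.transpose_submatrix, Matrix.det_transpose] at this

/-- `A` and `B` differ by unimodular row and column operations. -/
def UnimodularEquiv {n : ℕ} (A B : Matrix (Fin n) (Fin n) ℤ) : Prop :=
  ∃ U V : Matrix (Fin n) (Fin n) ℤ, IsUnit U.det ∧ IsUnit V.det ∧ A = U * B * V

namespace UnimodularEquiv

variable {n : ℕ} {A B C : Matrix (Fin n) (Fin n) ℤ}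

lemma symm (h : UnimodularEquiv A B) : UnimodularEquiv B A := by
  obtain ⟨U, V, hU, hV, rfl⟩ := h
  refine ⟨U⁻¹, V⁻¹, Matrix.isUnit_nonsing_inv_det U hU, Matrix.isUnit_nonsing_inv_det V hV, ?_⟩
  rw [Matrix.mul_assoc U, Matrix.nonsing_inv_mul_cancel_left _ _ hU,
    Matrix.mul_nonsing_inv_cancel_right _ _ hV]

lemma trans (h : UnimodularEquiv A B) (h' : UnimodularEquiv B C) : UnimodularEquiv A C := by
  obtain ⟨U, V, hU, hV, rfl⟩ := h
  obtain ⟨U', V', hU', hV', rfl⟩ := h'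
  refine ⟨U * U', V' * V, ?_, ?_, by simp only [Matrix.mul_assoc]⟩
  · rw [Matrix.det_mul]; exact hU.mul hU'
  · rw [Matrix.det_mul]; exact hV'.mul hV

lemma mul_left {U : Matrix (Fin n) (Fin n) ℤ} (hU : IsUnit U.det) :
    UnimodularEquiv (U * A) A :=
  ⟨U, 1, hU, by simp, by simp⟩

lemma dvd_minors (h : UnimodularEquiv A B) {k : ℕ} {d : ℤ}
    (hB : ∀ f g : Fin k → Fin n, d ∣ (B.submatrix f g).det) (f g : Fin k → Fin n) :
    d ∣ (A.submatrix f g).det := by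
  obtain ⟨U, V, -, -, rfl⟩ := h
  exact dvd_minors_mul_right (dvd_minors_mul_left hB) f g

lemma associated_det (h : UnimodularEquiv A B) : Associated A.det B.det := by
  obtain ⟨U, V, hU, hV, rfl⟩ := h
  rw [Matrix.det_mul, Matrix.det_mul, mul_right_comm, mul_comm]
  exact associated_mul_unit_left _ _ (hU.mul hV)

end UnimodularEquiv

/-- It suffices to test divisibility of minors on increasing selections of rows and columns. -/
lemma dvd_detDiv_iff {n k : ℕ} {d : ℤ} {C : Matrix (Fin n) (Fin n) ℤ} :
    d ∣ detDiv n k C ↔ ∀ f g : Fin k → Fin n, d ∣ (C.submatrix f g).det := by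
  rw [detDiv, Finset.dvd_gcd_iff]
  refine ⟨fun h f g => ?_, fun h fg _ => h _ _⟩
  by_cases hf : Function.Injective f
  swap
  · obtain ⟨a, b, hab, hne⟩ := Function.not_injective_iff.1 hf
    rw [Matrix.det_zero_of_row_eq hne (by ext j; simp [hab])]
    exact dvd_zero d
  by_cases hg : Function.Injective g
  swap
  · obtain ⟨a, b, hab, hne⟩ := Function.not_injective_iff.1 hg
    rw [Matrix.det_zero_of_column_eq hne (by intro j; simp [hab])]
    exact dvd_zero d
  have hf' : StrictMono (f ∘ Tuple.sort f) :=
    (Tuple.monotone_sort f).strictMono_of_injective (hf.comp (Tuple.sort f).injective)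
  have hg' : StrictMono (g ∘ Tuple.sort g) :=
    (Tuple.monotone_sort g).strictMono_of_injective (hg.comp (Tuple.sort g).injective)
  have h1 := h (f ∘ Tuple.sort f, g ∘ Tuple.sort g)
    (by simpa using ⟨fun a b hab => hf' hab, fun a b hab => hg' hab⟩)
  have h2 : C.submatrix (f ∘ Tuple.sort f) (g ∘ Tuple.sort g) =
      ((C.submatrix f g).submatrix (Tuple.sort f) id).submatrix id (Tuple.sort g) := rfl
  rw [h2, Matrix.det_permute', Matrix.det_permute, ← mul_assoc] at h1
  refine (IsUnit.dvd_mul_left ?_).1 h1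
  exact ((Equiv.Perm.sign _).isUnit.map (Int.castRingHom ℤ)).mul
    ((Equiv.Perm.sign _).isUnit.map (Int.castRingHom ℤ))

lemma detDiv_nonneg (n k : ℕ) (C : Matrix (Fin n) (Fin n) ℤ) : 0 ≤ detDiv n k C := by
  rw [detDiv, ← Finset.normalize_gcd]
  exact Int.nonneg_of_normalize_eq_self (normalize_idem _)

lemma UnimodularEquiv.detDiv_eq {n : ℕ} {A B : Matrix (Fin n) (Fin n) ℤ}
    (h : UnimodularEquiv A B) (k : ℕ) : detDiv n k A = detDiv n k B := by
  refine Int.dvd_antisymm (detDiv_nonneg _ _ _) (detDiv_nonneg _ _ _) ?_ ?_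
  · exact dvd_detDiv_iff.2 (h.symm.dvd_minors (dvd_detDiv_iff.1 dvd_rfl))
  · exact dvd_detDiv_iff.2 (h.dvd_minors (dvd_detDiv_iff.1 dvd_rfl))

lemma detDiv_self {n : ℕ} (C : Matrix (Fin n) (Fin n) ℤ) : detDiv n n C = |C.det| := by
  refine Int.dvd_antisymm (detDiv_nonneg _ _ _) (abs_nonneg _) ?_ ?_
  · rw [dvd_abs]
    simpa using dvd_detDiv_iff.1 (dvd_refl (detDiv n n C)) id id
  · rw [abs_dvd, dvd_detDiv_iff]
    intro f g
    have : C.submatrix f g = (1 : Matrix (Fin n) (Fin n) ℤ).submatrix f id * C *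
        (1 : Matrix (Fin n) (Fin n) ℤ).submatrix id g := by
      ext i j
      simp [Matrix.mul_apply, Matrix.one_apply]
    rw [this, Matrix.det_mul, Matrix.det_mul]
    exact ((dvd_mul_left _ _).mul_right _)

lemma det_Dmat {n p : ℕ} (hn : 2 ≤ n) : (Dmat n p).det = (p : ℤ) ^ n := by
  obtain ⟨m, rfl⟩ := Nat.exists_eq_add_of_le' hn
  rw [Dmat, Matrix.det_diagonal, Fin.prod_univ_succ, Fin.prod_univ_castSucc]
  have h (i : Fin m) : (i : ℕ) ≠ m := i.2.ne
  simp [h]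
  ring

lemma det_diagonal_submatrix {n k : ℕ} (d : Fin n → ℤ) (f g : Fin k → Fin n) :
    ((Matrix.diagonal d).submatrix f g).det =
      (∏ i, d (f i)) * ((1 : Matrix (Fin n) (Fin n) ℤ).submatrix f g).det := by
  rw [← Matrix.det_mul_column]
  congr 1
  ext i j
  simp [Matrix.diagonal_apply, Matrix.one_apply]

lemma pow_dvd_detDiv_Dmat {n p k : ℕ} : (p : ℤ) ^ (k - 1) ∣ detDiv n k (Dmat n p) := by
  rw [dvd_detDiv_iff]
  intro f g
  obtain _ | k := k
  · simp
  by_cases hf : Function.Injective f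
  swap
  · obtain ⟨a, b, hab, hne⟩ := Function.not_injective_iff.1 hf
    rw [Matrix.det_zero_of_row_eq hne (by ext j; simp [hab])]
    exact dvd_zero _
  obtain ⟨i₀, hi₀⟩ : ∃ i₀, ∀ i, i ≠ i₀ → (f i : ℕ) ≠ 0 := by
    by_cases h : ∃ i, (f i : ℕ) = 0
    · obtain ⟨i₀, h₀⟩ := h
      exact ⟨i₀, fun i hi h => hi (hf (Fin.ext (h.trans h₀.symm)))⟩
    · push Not at h
      exact ⟨0, fun i _ => h i⟩
  rw [Dmat, det_diagonal_submatrix, ← Finset.mul_prod_erase _ _ (Finset.mem_univ i₀)]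
  refine Dvd.dvd.mul_right (Dvd.dvd.mul_left ?_ _) _
  calc (p : ℤ) ^ (k + 1 - 1) = ∏ _i ∈ Finset.univ.erase i₀, (p : ℤ) := by simp
    _ ∣ _ := Finset.prod_dvd_prod_of_dvd _ _ fun i hi => by
      rw [if_neg (hi₀ i (Finset.ne_of_mem_erase hi))]
      split_ifs
      · exact dvd_pow_self _ two_ne_zero
      · exact dvd_rfl

lemma detDiv_Dmat {n p k : ℕ} (hk : 1 ≤ k) (hkn : k ≤ n - 1) :
    detDiv n k (Dmat n p) = (p : ℤ) ^ (k - 1) := by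
  refine Int.dvd_antisymm (detDiv_nonneg _ _ _) (by positivity) ?_ pow_dvd_detDiv_Dmat
  obtain ⟨k, rfl⟩ := Nat.exists_eq_add_of_le' hk
  have h := dvd_detDiv_iff.1 (dvd_refl (detDiv n (k + 1) (Dmat n p)))
    (Fin.castLE (by omega)) (Fin.castLE (by omega))
  nth_rw 2 [Dmat] at h
  rw [Matrix.submatrix_diagonal _ _ (Fin.castLE_injective _), Matrix.det_diagonal,
    Fin.prod_univ_succ] at h
  have hne (i : Fin k) : (i : ℕ) + 1 ≠ n - 1 := by have := i.2; omega
  simpa [hne] using h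

/-- Integer matrices of nonzero determinant with the same row lattice differ by a unimodular
left factor. -/
lemma exists_unimodular_of_span_eq {n : ℕ} {A B : Matrix (Fin n) (Fin n) ℤ} (hA : A.det ≠ 0)
    (h : Submodule.span ℤ (Set.range A.row) = Submodule.span ℤ (Set.range B.row)) :
    ∃ U : Matrix (Fin n) (Fin n) ℤ, IsUnit U.det ∧ A = U * B := by
  have key {A B : Matrix (Fin n) (Fin n) ℤ}
      (h : Submodule.span ℤ (Set.range A.row) ≤ Submodule.span ℤ (Set.range B.row)) :
      ∃ U : Matrix (Fin n) (Fin n) ℤ, A = U * B := by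
    have h' (i : Fin n) : ∃ c : Fin n → ℤ, ∑ k, c k • B.row k = A.row i :=
      (Submodule.mem_span_range_iff_exists_fun ℤ).1 (h (Submodule.subset_span ⟨i, rfl⟩))
    choose c hc using h'
    refine ⟨Matrix.of c, ?_⟩
    ext i j
    simpa [Matrix.mul_apply] using (congrFun (hc i) j).symm
  obtain ⟨U, hU⟩ := key h.le
  obtain ⟨W, hW⟩ := key h.ge
  refine ⟨U, ?_, hU⟩
  have hdet : U.det * W.det * A.det = 1 * A.det := by
    rw [mul_assoc, ← Matrix.det_mul W, ← hW, ← Matrix.det_mul, ← hU, one_mul]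
  exact IsUnit.of_mul_eq_one _ (mul_right_cancel₀ hA hdet)

lemma exists_unimodularEquiv_diagonal {n : ℕ} {M : Matrix (Fin n) (Fin n) ℤ} (hM : M.det ≠ 0) :
    ∃ a : Fin n → ℤ, UnimodularEquiv M (Matrix.diagonal a) := by
  have hli : LinearIndependent ℤ M.row := Matrix.linearIndependent_rows_of_det_ne_zero hM
  obtain ⟨b, a, ab, hab⟩ := Submodule.exists_smith_normal_form_of_rank_eq (Pi.basisFun ℤ (Fin n))
    (N := Submodule.span ℤ (Set.range M.row)) (by simp [finrank_span_eq_card hli])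
  let V : Matrix (Fin n) (Fin n) ℤ := Matrix.of fun i => b i
  have hV : IsUnit V.det := by
    have := (Pi.basisFun ℤ (Fin n)).isUnit_det b
    rwa [Pi.basisFun_det] at this
  have hspan : Submodule.span ℤ (Set.range M.row) =
      Submodule.span ℤ (Set.range (Matrix.diagonal a * V).row) := by
    have h1 : Set.range (Matrix.diagonal a * V).row =
        (Submodule.span ℤ (Set.range M.row)).subtype '' Set.range ab := by
      rw [← Set.range_comp]
      congr 1
      ext i j
      simp [hab, V]
    rw [h1, Submodule.span_image, ab.span_eq, Submodule.map_subtype_top]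
  obtain ⟨U, hU, h⟩ := exists_unimodular_of_span_eq hM hspan
  exact ⟨a, U, V, hU, hV, by rw [h, Matrix.mul_assoc]⟩

lemma unimodularEquiv_diagonal_of_perm {n : ℕ} {a d ε : Fin n → ℤ} (σ : Equiv.Perm (Fin n))
    (hε : IsUnit (∏ i, ε i)) (h : ∀ i, a i = ε i * d (σ i)) :
    UnimodularEquiv (Matrix.diagonal a) (Matrix.diagonal d) := by
  have hsign : IsUnit ((Equiv.Perm.sign σ : ℤˣ) : ℤ) := (Equiv.Perm.sign σ).isUnit
  refine ⟨Matrix.diagonal ε * (1 : Matrix (Fin n) (Fin n) ℤ).submatrix σ id,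
    (1 : Matrix (Fin n) (Fin n) ℤ).submatrix id σ, ?_, ?_, ?_⟩
  · rw [Matrix.det_mul, Matrix.det_diagonal, Matrix.det_permute, Matrix.det_one, mul_one]
    exact hε.mul hsign
  · rw [Matrix.det_permute', Matrix.det_one, mul_one]
    exact hsign
  · ext i j
    simp [Matrix.mul_assoc, Matrix.diagonal_apply, Matrix.mul_apply, Matrix.one_apply, h]
    grind

lemma exists_perm_apply_eq_apply_eq {α : Type*} [DecidableEq α] {r s x y : α} (hrs : r ≠ s)
    (hxy : x ≠ y) : ∃ σ : Equiv.Perm α, σ r = x ∧ σ s = y := by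
  refine ⟨(Equiv.swap r x).trans (Equiv.swap (Equiv.swap r x s) y), ?_, by simp⟩
  have : x ≠ Equiv.swap r x s := fun h =>
    hrs ((Equiv.swap r x).injective (by rw [← h, Equiv.swap_apply_left]))
  simp [Equiv.swap_apply_of_ne_of_ne this hxy]

lemma prod_one_sq_else (n p : ℕ) {r s : Fin n} (hrs : r ≠ s) :
    (∏ i, if i = r then 1 else if i = s then (p : ℤ) ^ 2 else (p : ℤ)) = (p : ℤ) ^ n := by
  have hn : 2 ≤ n := by have := r.2; have := s.2; have := Fin.val_ne_iff.2 hrs; omega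
  rw [← Finset.mul_prod_erase _ _ (Finset.mem_univ r),
    ← Finset.mul_prod_erase _ _ (Finset.mem_erase.2 ⟨hrs.symm, Finset.mem_univ s⟩),
    Finset.prod_congr rfl (g := fun _ => (p : ℤ))]
  · rw [Finset.prod_const, Finset.card_erase_of_mem (by simp [hrs.symm]),
      Finset.card_erase_of_mem (Finset.mem_univ r)]
    simp only [hrs.symm, if_true, if_false, one_mul, Finset.card_univ, Fintype.card_fin]
    rw [← pow_add]
    congr 1
    omega
  · intro i hi
    simp only [Finset.mem_erase] at hi
    rw [if_neg hi.2.1, if_neg hi.1]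

/-- If `∏ a i = ± p ^ n` and exactly one `a r` is prime to `p`, then up to units the `a i` are
`1` once, `p ^ 2` once and `p` otherwise. -/
lemma exists_eq_unit_mul_of_associated_prod {n p : ℕ} (hn : 2 ≤ n) (hp : p.Prime) {a : Fin n → ℤ}
    (hdet : Associated (∏ i, a i) ((p : ℤ) ^ n)) {r : Fin n} (hr : ¬ (p : ℤ) ∣ a r)
    (ha : ∀ i, i ≠ r → (p : ℤ) ∣ a i) :
    ∃ s, r ≠ s ∧ ∃ ε : Fin n → ℤ, IsUnit (∏ i, ε i) ∧
      ∀ i, a i = ε i * if i = r then 1 else if i = s then (p : ℤ) ^ 2 else (p : ℤ) := by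
  have hpZ : Prime (p : ℤ) := Nat.prime_iff_prime_int.1 hp
  have hb (i : Fin n) : ∃ b, a i = b * if i = r then 1 else (p : ℤ) := by
    split_ifs with h
    · exact ⟨a i, by simp⟩
    · obtain ⟨b, hb⟩ := ha i h
      exact ⟨b, by rw [hb, mul_comm]⟩
  choose b hb using hb
  have hprod : (∏ i, if i = r then 1 else (p : ℤ)) = (p : ℤ) ^ (n - 1) := by
    simp [Finset.prod_ite, Finset.filter_ne']
  have hpb : (p : ℤ) ∣ ∏ i, b i := by
    have h1 : (p : ℤ) ^ n ∣ ∏ i, a i := hdet.symm.dvd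
    rw [Finset.prod_congr rfl fun i _ => hb i, Finset.prod_mul_distrib, hprod,
      ← mul_pow_sub_one (by omega : n ≠ 0)] at h1
    exact Int.dvd_of_mul_dvd_mul_right (pow_ne_zero _ hpZ.ne_zero) h1
  obtain ⟨s, -, hs⟩ := hpZ.exists_mem_finset_dvd hpb
  have hrs : r ≠ s := by
    rintro rfl
    exact hr (by simpa [hb r] using hs)
  have hε (i : Fin n) : ∃ ε,
      a i = ε * if i = r then 1 else if i = s then (p : ℤ) ^ 2 else (p : ℤ) := by
    by_cases hir : i = r
    · exact ⟨a i, by simp [hir]⟩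
    by_cases his : i = s
    · obtain ⟨c, hc⟩ := hs
      refine ⟨c, ?_⟩
      rw [hb, if_neg hir, if_neg hir, if_pos his, his, hc]
      ring
    · exact ⟨b i, by simp only [if_neg hir, if_neg his, hb i]⟩
  choose ε hε using hε
  refine ⟨s, hrs, ε, ?_, hε⟩
  rw [Finset.prod_congr rfl fun i _ => hε i, Finset.prod_mul_distrib,
    prod_one_sq_else n p hrs] at hdet
  have : Associated ((∏ i, ε i) * (p : ℤ) ^ n) (1 * (p : ℤ) ^ n) := by
    rwa [one_mul]
  exact associated_one_iff_isUnit.1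
    (this.of_mul_right (Associated.refl _) (pow_ne_zero _ hpZ.ne_zero))

lemma diagonal_unimodularEquiv_Dmat {n p : ℕ} (hn : 2 ≤ n) (hp : p.Prime) {a : Fin n → ℤ}
    (hdet : Associated (∏ i, a i) ((p : ℤ) ^ n)) {r : Fin n} (hr : ¬ (p : ℤ) ∣ a r)
    (ha : ∀ i, i ≠ r → (p : ℤ) ∣ a i) :
    UnimodularEquiv (Matrix.diagonal a) (Dmat n p) := by
  obtain ⟨s, hrs, ε, hε, h⟩ := exists_eq_unit_mul_of_associated_prod hn hp hdet hr ha
  obtain ⟨m, rfl⟩ := Nat.exists_eq_add_of_le' hn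
  obtain ⟨σ, hσr, hσs⟩ := exists_perm_apply_eq_apply_eq hrs
    (Fin.last_pos.ne : (0 : Fin (m + 2)) ≠ Fin.last (m + 1))
  refine unimodularEquiv_diagonal_of_perm σ hε fun i => ?_
  have h0 : (σ i : ℕ) = 0 ↔ i = r := by
    rw [← σ.apply_eq_iff_eq, hσr, Fin.ext_iff, Fin.val_zero]
  have h1 : (σ i : ℕ) = m + 2 - 1 ↔ i = s := by
    rw [← σ.apply_eq_iff_eq, hσs, Fin.ext_iff, Fin.val_last, Nat.add_succ_sub_one]
  rw [h i]
  simp only [h0, h1]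

/-- A matrix of determinant `±p ^ n` whose reduction modulo `p` has rank one is equivalent to
`diag(1, p, …, p, p²)`. -/
lemma unimodularEquiv_Dmat {n p : ℕ} (hn : 2 ≤ n) (hp : p.Prime) {M : Matrix (Fin n) (Fin n) ℤ}
    (hdet : Associated M.det ((p : ℤ) ^ n)) (h1 : ¬ (p : ℤ) ∣ detDiv n 1 M)
    (h2 : (p : ℤ) ∣ detDiv n 2 M) : UnimodularEquiv M (Dmat n p) := by
  have hpZ : Prime (p : ℤ) := Nat.prime_iff_prime_int.1 hp
  have hM : M.det ≠ 0 := hdet.ne_zero_iff.2 (pow_ne_zero _ hpZ.ne_zero)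
  obtain ⟨a, ha⟩ := exists_unimodularEquiv_diagonal hM
  rw [ha.detDiv_eq, dvd_detDiv_iff] at h1 h2
  obtain ⟨r, hr⟩ : ∃ r, ¬ (p : ℤ) ∣ a r := by
    by_contra! h
    refine h1 fun f g => ?_
    rw [det_diagonal_submatrix]
    simpa using (h (f 0)).mul_right _
  refine ha.trans (diagonal_unimodularEquiv_Dmat hn hp ?_ hr fun i hi => ?_)
  · rw [← Matrix.det_diagonal]
    exact ha.associated_det.symm.trans hdet
  · have := h2 ![i, r] ![i, r]
    rw [Matrix.det_fin_two] at this
    simp [hi] at this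
    exact (hpZ.dvd_or_dvd this).resolve_right hr

/-- Row-style Hermite normal form with positive pivots. -/
structure IsHermite {n : ℕ} (C : Matrix (Fin n) (Fin n) ℤ) : Prop where
  upper : ∀ i j, j < i → C i j = 0
  pos : ∀ i, 0 < C i i
  reduced : ∀ i j, i < j → 0 ≤ C i j ∧ C i j < C j j

lemma IsHermite.det_eq {n : ℕ} {C : Matrix (Fin n) (Fin n) ℤ} (hC : IsHermite C) :
    C.det = ∏ i, C i i :=
  Matrix.det_of_isUpperTriangular fun i j h => hC.upper i j h

lemma IsHermite.eq_of_eq_mul {n : ℕ} {C C' U : Matrix (Fin n) (Fin n) ℤ} (hC : IsHermite C)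
    (hC' : IsHermite C') (hU : IsUnit U.det) (h : C' = U * C) : C' = C := by
  have entry (i j : Fin n) : C' i j = ∑ k, U i k * C k j := by rw [h, Matrix.mul_apply]
  have upper (i j : Fin n) : j < i → U i j = 0 := by
    induction j using WellFoundedLT.induction with
    | _ j ih =>
      intro hj
      have hsum : ∑ k, U i k * C k j = U i j * C j j := by
        refine Finset.sum_eq_single j (fun k _ hk => ?_) (by simp)
        rcases lt_or_gt_of_ne hk with hk | hk
        · rw [ih k hk (hk.trans hj), zero_mul]
        · rw [hC.upper k j hk, mul_zero]
      have h0 := entry i j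
      rw [hC'.upper i j hj, hsum] at h0
      exact (mul_eq_zero.1 h0.symm).resolve_right (hC.pos j).ne'
  have diag (i : Fin n) : U i i = 1 := by
    have hsum : ∑ k, U i k * C k i = U i i * C i i := by
      refine Finset.sum_eq_single i (fun k _ hk => ?_) (by simp)
      rcases lt_or_gt_of_ne hk with hk | hk
      · rw [upper i k hk, zero_mul]
      · rw [hC.upper k i hk, mul_zero]
    have hpos : 0 < U i i := by
      have := hC'.pos i
      rw [entry, hsum] at this
      exact pos_of_mul_pos_left this (hC.pos i).le
    rw [Matrix.det_of_isUpperTriangular fun i j h => upper i j h] at hU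
    have := isUnit_of_dvd_unit (Finset.dvd_prod_of_mem (fun i => U i i) (Finset.mem_univ i)) hU
    exact (Int.isUnit_iff.1 this).resolve_right (by omega)
  have off (i j : Fin n) : i < j → U i j = 0 := by
    induction j using WellFoundedLT.induction with
    | _ j ih =>
      intro hj
      have hsum : ∑ k, U i k * C k j = U i i * C i j + U i j * C j j := by
        refine Finset.sum_eq_add i j hj.ne (fun k _ hk => ?_) (by simp) (by simp)
        rcases lt_or_gt_of_ne hk.2 with hk' | hk'
        · rcases lt_or_gt_of_ne hk.1 with hk'' | hk''
          · rw [upper i k hk'', zero_mul]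
          · rw [ih k hk' hk'', zero_mul]
        · rw [hC.upper k j hk', mul_zero]
      have hjj : C' j j = C j j := by
        rw [entry j j, Finset.sum_eq_single j (fun k _ hk => ?_) (by simp), diag, one_mul]
        rcases lt_or_gt_of_ne hk with hk | hk
        · rw [upper j k hk, zero_mul]
        · rw [hC.upper k j hk, mul_zero]
      have h0 := entry i j
      rw [hsum, diag, one_mul] at h0
      have h1 := hC.reduced i j hj
      have h2 := hC'.reduced i j hj
      have h3 := hC.pos j
      rw [hjj] at h2
      have h4 : U i j < 1 := by nlinarith
      have h5 : -1 < U i j := by nlinarith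
      omega
  have hU1 : U = 1 := by
    ext i j
    rcases lt_trichotomy i j with hij | rfl | hij
    · rw [off i j hij, Matrix.one_apply_ne hij.ne]
    · rw [diag, Matrix.one_apply_eq]
    · rw [upper i j hij, Matrix.one_apply_ne hij.ne']
  rw [h, hU1, Matrix.one_mul]

/-- A full-rank lattice contains, for each coordinate, a vector with minimal leading entry
in that coordinate. -/
lemma exists_pivot {n : ℕ} {N : Submodule ℤ (Fin n → ℤ)} {D : ℤ} (hD : D ≠ 0) (i : Fin n)
    (hN : D • (Pi.single i 1 : Fin n → ℤ) ∈ N) :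
    ∃ v ∈ N, (∀ k < i, v k = 0) ∧ 0 < v i ∧
      ∀ x ∈ N, (∀ k < i, x k = 0) → v i ∣ x i := by
  let Z : Submodule ℤ (Fin n → ℤ) :=
    { carrier := {x | ∀ k < i, x k = 0}
      add_mem' := fun ha hb k hk => by simp [ha k hk, hb k hk]
      zero_mem' := fun _ _ => rfl
      smul_mem' := fun c x hx k hk => by simp [hx k hk] }
  let J : Ideal ℤ := (N ⊓ Z).map (LinearMap.proj i)
  have hJ : D ∈ J := by
    refine ⟨D • Pi.single i 1, ⟨hN, fun k hk => ?_⟩, by simp⟩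
    simp [Pi.single_eq_of_ne hk.ne]
  set g := Submodule.IsPrincipal.generator J with hg
  have hg0 : g ≠ 0 := fun h => by
    rw [hg, ← Submodule.IsPrincipal.eq_bot_iff_generator_eq_zero] at h
    rw [h] at hJ
    exact hD hJ
  have habs : |g| ∈ J := by
    rcases abs_choice g with h | h <;> rw [h]
    · exact Submodule.IsPrincipal.generator_mem J
    · exact J.neg_mem (Submodule.IsPrincipal.generator_mem J)
  obtain ⟨v, ⟨hvN, hvZ⟩, hv⟩ := habs
  have hv' : v i = |g| := hv
  refine ⟨v, hvN, hvZ, by rw [hv']; exact abs_pos.2 hg0, fun x hx hxZ => ?_⟩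
  rw [hv', abs_dvd]
  exact (Submodule.IsPrincipal.mem_iff_generator_dvd J).1 ⟨x, ⟨hx, hxZ⟩, rfl⟩

/-- Every full-rank integer matrix has a Hermite normal form. -/
lemma exists_isHermite {n : ℕ} {M : Matrix (Fin n) (Fin n) ℤ} (hM : M.det ≠ 0) :
    ∃ U C : Matrix (Fin n) (Fin n) ℤ, IsUnit U.det ∧ IsHermite C ∧ M = U * C := by
  set N : Submodule ℤ (Fin n → ℤ) := Submodule.span ℤ (Set.range M.row) with hNdef
  have hdet (i : Fin n) : M.det • (Pi.single i 1 : Fin n → ℤ) ∈ N := by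
    rw [hNdef, Submodule.mem_span_range_iff_exists_fun]
    refine ⟨M.adjugate i, ?_⟩
    ext j
    have := congrFun (congrFun M.adjugate_mul i) j
    rw [Matrix.mul_apply] at this
    simpa [Matrix.one_apply, Pi.single_apply, eq_comm] using this
  choose w hwN hw0 hwpos hwdvd using fun i => exists_pivot hM i (hdet i)
  have reduce (i : Fin n) (s : ℕ) : ∃ y ∈ N, (∀ k ≤ i, y k = w i k) ∧
      ∀ k, i < k → (k : ℕ) < s → 0 ≤ y k ∧ y k < w k k := by
    induction s with
    | zero => exact ⟨w i, hwN i, fun _ _ => rfl, fun k _ hk => absurd hk (by omega)⟩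
    | succ s ih =>
      obtain ⟨y, hyN, hy, hyred⟩ := ih
      by_cases hs : ∃ t : Fin n, (t : ℕ) = s ∧ i < t
      · obtain ⟨t, hts, hit⟩ := hs
        refine ⟨y - (y t / w t t) • w t, N.sub_mem hyN (N.smul_mem _ (hwN t)),
          fun k hk => ?_, fun k hk hks => ?_⟩
        · simp [hw0 t k (hk.trans_lt hit), hy k hk]
        · rcases (by omega : (k : ℕ) < s ∨ (k : ℕ) = s) with hlt | heq
          · have hkt : k < t := by rw [Fin.lt_def]; omega
            simpa [hw0 t k hkt] using hyred k hk hlt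
          · obtain rfl : k = t := Fin.ext (heq.trans hts.symm)
            have : y k - y k / w k k * w k k = y k % w k k := by
              rw [Int.emod_def, mul_comm]
            simp only [Pi.sub_apply, Pi.smul_apply, smul_eq_mul, this]
            exact ⟨Int.emod_nonneg _ (hwpos k).ne', Int.emod_lt_of_pos _ (hwpos k)⟩
      · refine ⟨y, hyN, hy, fun k hk hks => hyred k hk ?_⟩
        by_contra hlt
        exact hs ⟨k, by omega, hk⟩
  choose C hCN hCle hCred using fun i => reduce i n
  have hCdiag (i : Fin n) : C i i = w i i := hCle i i le_rfl
  have hC : IsHermite (Matrix.of C) := by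
    refine ⟨fun i j hij => ?_, fun i => ?_, fun i j hij => ?_⟩
    · rw [Matrix.of_apply, hCle i j hij.le, hw0 i j hij]
    · rw [Matrix.of_apply, hCdiag]
      exact hwpos i
    · simp only [Matrix.of_apply, hCdiag]
      exact hCred i j hij j.2
  have hle : Submodule.span ℤ (Set.range (Matrix.of C).row) ≤ N := by
    rw [Submodule.span_le]
    rintro _ ⟨i, rfl⟩
    exact hCN i
  have approx {x : Fin n → ℤ} (hx : x ∈ N) (s : ℕ) :
      ∃ y ∈ Submodule.span ℤ (Set.range (Matrix.of C).row),
        ∀ k : Fin n, (k : ℕ) < s → x k = y k := by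
    induction s with
    | zero => exact ⟨0, Submodule.zero_mem _, fun k hk => absurd hk (by omega)⟩
    | succ s ih =>
      obtain ⟨y, hy, hxy⟩ := ih
      by_cases hs : s < n
      · let t : Fin n := ⟨s, hs⟩
        obtain ⟨c, hc⟩ := hwdvd t (x - y) (N.sub_mem hx (hle hy))
          fun k hk => sub_eq_zero.2 (hxy k hk)
        refine ⟨y + c • C t, Submodule.add_mem _ hy
          (Submodule.smul_mem _ _ (Submodule.subset_span ⟨t, rfl⟩)), fun k hk => ?_⟩
        rcases (by omega : (k : ℕ) < s ∨ (k : ℕ) = s) with hlt | heq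
        · have := hC.upper t k hlt
          rw [Matrix.of_apply] at this
          simp [this, hxy k hlt]
        · obtain rfl : k = t := Fin.ext heq
          rw [Pi.sub_apply] at hc
          simp only [Pi.add_apply, Pi.smul_apply, smul_eq_mul, hCdiag]
          linarith
      · exact ⟨y, hy, fun k hk => hxy k (by omega)⟩
  have hspan : N = Submodule.span ℤ (Set.range (Matrix.of C).row) := by
    refine le_antisymm (fun x hx => ?_) hle
    obtain ⟨y, hy, hxy⟩ := approx hx n
    rwa [show x = y from funext fun k => hxy k k.2]
  obtain ⟨U, hU, h⟩ := exists_unimodular_of_span_eq hM hspan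
  exact ⟨U, Matrix.of C, hU, hC, h⟩

lemma exists_toQ_of_mem_Lambda {n : ℕ} {γ : Matrix (Fin n) (Fin n) ℚ} (h : γ ∈ Lambda n) :
    ∃ U : Matrix (Fin n) (Fin n) ℤ, IsUnit U.det ∧ γ = toQ n U := by
  obtain ⟨hint, hdet⟩ := h
  choose U hU using hint
  have hγ : γ = toQ n (Matrix.of U) := by
    ext i j
    exact hU i j
  refine ⟨Matrix.of U, ?_, hγ⟩
  have hcast : γ.det = ((Matrix.of U).det : ℤ) := by
    rw [hγ, Int.cast_det]
    rfl
  rw [hcast] at hdet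
  exact Int.isUnit_iff.2 (by exact_mod_cast hdet)

lemma toQ_mem_Lambda {n : ℕ} {U : Matrix (Fin n) (Fin n) ℤ} (h : IsUnit U.det) :
    toQ n U ∈ Lambda n := by
  refine ⟨fun i j => ⟨U i j, rfl⟩, ?_⟩
  have hcast : (toQ n U).det = (U.det : ℤ) := by
    rw [Int.cast_det]
    rfl
  rw [hcast]
  exact_mod_cast Int.isUnit_iff.1 h

lemma toQ_mul {n : ℕ} (A B : Matrix (Fin n) (Fin n) ℤ) : toQ n (A * B) = toQ n A * toQ n B :=
  Matrix.map_mul (f := Int.castRingHom ℚ)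

lemma toQ_injective (n : ℕ) : Function.Injective (toQ n) :=
  Matrix.map_injective Int.cast_injective

lemma mem_rightCoset_toQ {n : ℕ} {C : Matrix (Fin n) (Fin n) ℤ} {m : Matrix (Fin n) (Fin n) ℚ} :
    m ∈ rightCoset n (toQ n C) ↔
      ∃ U : Matrix (Fin n) (Fin n) ℤ, IsUnit U.det ∧ m = toQ n (U * C) := by
  constructor
  · rintro ⟨γ, hγ, rfl⟩
    obtain ⟨U, hU, rfl⟩ := exists_toQ_of_mem_Lambda hγ
    exact ⟨U, hU, (toQ_mul _ _).symm⟩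
  · rintro ⟨U, hU, rfl⟩
    exact ⟨toQ n U, toQ_mem_Lambda hU, toQ_mul _ _⟩

lemma mem_doubleCoset_toQ {n : ℕ} {D : Matrix (Fin n) (Fin n) ℤ}
    {m : Matrix (Fin n) (Fin n) ℚ} :
    m ∈ doubleCoset n (toQ n D) ↔ ∃ M, UnimodularEquiv M D ∧ m = toQ n M := by
  constructor
  · rintro ⟨γ₁, h₁, γ₂, h₂, rfl⟩
    obtain ⟨U, hU, rfl⟩ := exists_toQ_of_mem_Lambda h₁
    obtain ⟨V, hV, rfl⟩ := exists_toQ_of_mem_Lambda h₂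
    exact ⟨U * D * V, ⟨U, V, hU, hV, rfl⟩, by rw [toQ_mul, toQ_mul]⟩
  · rintro ⟨_, ⟨U, V, hU, hV, rfl⟩, rfl⟩
    exact ⟨toQ n U, toQ_mem_Lambda hU, toQ n V, toQ_mem_Lambda hV, by rw [toQ_mul, toQ_mul]⟩

lemma isHermite_of_mem_R0 {n p : ℕ} (hp : p.Prime) {C : Matrix (Fin n) (Fin n) ℤ}
    (hC : C ∈ R0 n p) : IsHermite C := by
  obtain ⟨hup, -, -, hdiag, hred⟩ := hC
  refine ⟨hup, fun i => ?_, fun i j hij => ?_⟩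
  · rw [hdiag]
    exact_mod_cast hp.pos
  · rw [hdiag]
    exact hred i j hij

lemma unimodularEquiv_Dmat_of_mem_R0 {n p : ℕ} (hn : 2 ≤ n) (hp : p.Prime)
    {C : Matrix (Fin n) (Fin n) ℤ} (hC : C ∈ R0 n p) : UnimodularEquiv C (Dmat n p) := by
  obtain ⟨-, hdiv, hdet, -, -⟩ := hC
  refine unimodularEquiv_Dmat hn hp ?_ ?_ ?_
  · rw [← hdet, detDiv_self, Int.associated_iff_natAbs, Int.natAbs_abs]
  · rw [hdiv 1 le_rfl (by omega)]
    simpa using (Nat.prime_iff_prime_int.1 hp).not_dvd_one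
  · rcases hn.eq_or_lt with rfl | hn
    · rw [hdet]
      exact dvd_pow_self _ two_ne_zero
    · rw [hdiv 2 one_le_two (by omega)]
      simp

lemma isHermite_of_mem_R1 {n p : ℕ} (hp : p.Prime) {C : Matrix (Fin n) (Fin n) ℤ}
    (hC : C ∈ R1 n p) : IsHermite C := by
  obtain ⟨hup, hdiag, -, -, hred, -⟩ := hC
  refine ⟨hup, fun i => ?_, hred⟩
  have : 0 < (p : ℤ) := by exact_mod_cast hp.pos
  rcases hdiag i with h | h | h <;> rw [h] <;> positivity

lemma unimodularEquiv_Dmat_of_mem_R1 {n p : ℕ} (hn : 2 ≤ n) (hp : p.Prime)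
    {C : Matrix (Fin n) (Fin n) ℤ} (hC : C ∈ R1 n p) : UnimodularEquiv C (Dmat n p) := by
  have hC' := isHermite_of_mem_R1 hp hC
  obtain ⟨hup, hdiag, ⟨r, hr, hr'⟩, ⟨s, hs, hs'⟩, -, hdvd⟩ := hC
  have hp1 : ¬ (p : ℤ) ∣ 1 := (Nat.prime_iff_prime_int.1 hp).not_dvd_one
  have hp2 : (p : ℤ) ∣ (p : ℤ) ^ 2 := dvd_pow_self _ two_ne_zero
  beta_reduce at hr hr' hs hs'
  have hrow (i j : Fin n) (hi : i ≠ r) : (p : ℤ) ∣ C i j := by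
    have hii : (p : ℤ) ∣ C i i := by
      rcases hdiag i with h | h | h
      · exact absurd (hr' i h) hi
      · rw [h]
      · rw [h]; exact hp2
    rcases lt_trichotomy i j with hij | rfl | hij
    · exact hdvd i j hij hii
    · exact hii
    · rw [hup i j hij]
      exact dvd_zero _
  refine unimodularEquiv_Dmat hn hp ?_ ?_ ?_
  · have hrs : r ≠ s := by
      rintro rfl
      exact hp1 (by rw [← hr, hs]; exact hp2)
    rw [hC'.det_eq, ← prod_one_sq_else n p hrs, Finset.prod_congr rfl fun i _ => ?_]
    split_ifs with h1 h2
    · rw [h1, hr]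
    · rw [h2, hs]
    · rcases hdiag i with h | h | h
      · exact absurd (hr' i h) h1
      · exact h
      · exact absurd (hs' i h) h2
  · intro h
    have := dvd_detDiv_iff.1 h (fun _ => r) (fun _ => r)
    exact hp1 (by simpa [hr] using this)
  · rw [dvd_detDiv_iff]
    intro f g
    rw [Matrix.det_fin_two]
    simp only [Matrix.submatrix_apply]
    by_cases h0 : f 0 = r
    · by_cases h1 : f 1 = r
      · rw [h0, h1, mul_comm, sub_self]
        exact dvd_zero _
      · exact dvd_sub ((hrow _ _ h1).mul_left _) ((hrow _ _ h1).mul_left _)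
    · exact dvd_sub ((hrow _ _ h0).mul_right _) ((hrow _ _ h0).mul_right _)

lemma mem_R0_or_mem_R1 {n p : ℕ} (hn : 2 ≤ n) (hp : p.Prime)
    {C : Matrix (Fin n) (Fin n) ℤ} (hC : IsHermite C) (h : UnimodularEquiv C (Dmat n p)) :
    C ∈ R0 n p ∨ C ∈ R1 n p := by
  have hpZ : Prime (p : ℤ) := Nat.prime_iff_prime_int.1 hp
  have hp0 : 0 < (p : ℤ) := by exact_mod_cast hp.pos
  have hp2 : 1 < (p : ℤ) := by exact_mod_cast hp.one_lt
  have hdet : Associated (∏ i, C i i) ((p : ℤ) ^ n) := by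
    rw [← hC.det_eq, ← det_Dmat hn]
    exact h.associated_det
  by_cases hall : ∀ i, (p : ℤ) ∣ C i i
  · left
    choose b hb using hall
    have hbunit : IsUnit (∏ i, b i) := by
      rw [Finset.prod_congr rfl fun i _ => hb i, Finset.prod_mul_distrib, Finset.prod_const,
        Finset.card_univ, Fintype.card_fin] at hdet
      have : Associated ((p : ℤ) ^ n * ∏ i, b i) ((p : ℤ) ^ n * 1) := by rwa [mul_one]
      exact associated_one_iff_isUnit.1
        (this.of_mul_left (Associated.refl _) (pow_ne_zero _ hpZ.ne_zero))
    have hdiag (i : Fin n) : C i i = p := by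
      have h1 := isUnit_of_dvd_unit (Finset.dvd_prod_of_mem b (Finset.mem_univ i)) hbunit
      have h2 : 0 < b i := pos_of_mul_pos_right (hb i ▸ hC.pos i) hp0.le
      rw [hb i, (Int.isUnit_iff.1 h1).resolve_right (by omega), mul_one]
    refine ⟨hC.upper, fun k hk hkn => ?_, ?_, hdiag, fun i j hij => ?_⟩
    · rw [h.detDiv_eq, detDiv_Dmat hk hkn]
    · rw [h.detDiv_eq, detDiv_self, det_Dmat hn, abs_of_pos (by positivity)]
    · rw [← hdiag j]
      exact hC.reduced i j hij
  · right
    push Not at hall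
    obtain ⟨r, hr⟩ := hall
    have hminor : (p : ℤ) ∣ detDiv n 2 C := by
      rw [h.detDiv_eq]
      simpa using pow_dvd_detDiv_Dmat (n := n) (p := p) (k := 2)
    have hminor (i j k l : Fin n) : (p : ℤ) ∣ C i k * C j l - C i l * C j k := by
      have := dvd_detDiv_iff.1 hminor ![i, j] ![k, l]
      rwa [Matrix.det_fin_two] at this
    have hother (i : Fin n) (hi : i ≠ r) : (p : ℤ) ∣ C i i := by
      have h1 := hminor i r i r
      have h2 : C i r * C r i = 0 := by
        rcases lt_or_gt_of_ne hi with hi | hi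
        · rw [hC.upper r i hi, mul_zero]
        · rw [hC.upper i r hi, zero_mul]
      rw [h2, sub_zero] at h1
      exact (hpZ.dvd_or_dvd h1).resolve_right hr
    obtain ⟨s, hrs, ε, hε, hCε⟩ := exists_eq_unit_mul_of_associated_prod hn hp hdet hr hother
    have hdiag (i : Fin n) :
        C i i = if i = r then 1 else if i = s then (p : ℤ) ^ 2 else (p : ℤ) := by
      have h1 := isUnit_of_dvd_unit (Finset.dvd_prod_of_mem ε (Finset.mem_univ i)) hε
      have h2 : 0 < ε i := by
        refine pos_of_mul_pos_left (hCε i ▸ hC.pos i) ?_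
        split_ifs <;> positivity
      rw [hCε i, (Int.isUnit_iff.1 h1).resolve_right (by omega), one_mul]
    have hrr : C r r = 1 := by rw [hdiag, if_pos rfl]
    have hsq : (p : ℤ) < (p : ℤ) ^ 2 := by nlinarith
    refine ⟨hC.upper, fun i => ?_, ⟨r, hrr, fun i hi => ?_⟩,
      ⟨s, by simp [hdiag, hrs.symm], fun i hi => ?_⟩, hC.reduced, fun i j hij hi => ?_⟩
    · rw [hdiag]
      split_ifs <;> simp
    · beta_reduce at hi
      rw [hdiag] at hi
      split_ifs at hi with h1 h2
      · exact h1
      · omega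
      · omega
    · beta_reduce at hi
      rw [hdiag] at hi
      split_ifs at hi with h1 h2
      · omega
      · exact h2
      · omega
    · have hir : i ≠ r := by
        rintro rfl
        exact hr hi
      have h0 : C i r = 0 := by
        rcases lt_or_gt_of_ne hir with hlt | hlt
        · have := hC.reduced i r hlt
          omega
        · exact hC.upper i r hlt
      simpa [hrr, h0] using hminor r i r j

lemma mem_R0_union_R1_iff {n p : ℕ} (hn : 2 ≤ n) (hp : p.Prime)
    {C : Matrix (Fin n) (Fin n) ℤ} :
    C ∈ R0 n p ∪ R1 n p ↔ IsHermite C ∧ UnimodularEquiv C (Dmat n p) := by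
  refine ⟨?_, fun h => mem_R0_or_mem_R1 hn hp h.1 h.2⟩
  rintro (h | h)
  · exact ⟨isHermite_of_mem_R0 hp h, unimodularEquiv_Dmat_of_mem_R0 hn hp h⟩
  · exact ⟨isHermite_of_mem_R1 hp h, unimodularEquiv_Dmat_of_mem_R1 hn hp h⟩

lemma disjoint_R0_R1 {n p : ℕ} (hp : p.Prime) : Disjoint (R0 n p) (R1 n p) := by
  refine Set.disjoint_left.2 fun C h0 h1 => ?_
  obtain ⟨-, -, -, hdiag, -⟩ := h0
  obtain ⟨-, -, ⟨r, hr, -⟩, -⟩ := h1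
  rw [hdiag] at hr
  exact hp.one_lt.ne' (by exact_mod_cast hr)

/-- Two Hermite normal forms whose right cosets meet coincide. -/
lemma IsHermite.eq_of_mem_rightCoset {n : ℕ} {C C' : Matrix (Fin n) (Fin n) ℤ} (hC : IsHermite C)
    (hC' : IsHermite C') {m : Matrix (Fin n) (Fin n) ℚ} (h : m ∈ rightCoset n (toQ n C))
    (h' : m ∈ rightCoset n (toQ n C')) : C = C' := by
  obtain ⟨U, hU, rfl⟩ := mem_rightCoset_toQ.1 h
  obtain ⟨U', hU', heq⟩ := mem_rightCoset_toQ.1 h'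
  refine hC'.eq_of_eq_mul (U := U⁻¹ * U') hC ?_ ?_
  · rw [Matrix.det_mul]
    exact (Matrix.isUnit_nonsing_inv_det U hU).mul hU'
  · rw [Matrix.mul_assoc, ← toQ_injective n heq, Matrix.nonsing_inv_mul_cancel_left _ _ hU]

lemma self_mem_rightCoset {n : ℕ} (C : Matrix (Fin n) (Fin n) ℤ) :
    toQ n C ∈ rightCoset n (toQ n C) :=
  mem_rightCoset_toQ.2 ⟨1, by simp, by rw [Matrix.one_mul]⟩

lemma exists_mem_rightCoset {n p : ℕ} (hn : 2 ≤ n) (hp : p.Prime)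
    {m : Matrix (Fin n) (Fin n) ℚ} (hm : m ∈ doubleCoset n (toQ n (Dmat n p))) :
    ∃ C ∈ R0 n p ∪ R1 n p, m ∈ rightCoset n (toQ n C) := by
  obtain ⟨M, hM, rfl⟩ := mem_doubleCoset_toQ.1 hm
  have hdet : M.det ≠ 0 := by
    rw [hM.associated_det.ne_zero_iff, det_Dmat hn]
    exact pow_ne_zero _ (by exact_mod_cast hp.ne_zero)
  obtain ⟨U, C, hU, hC, rfl⟩ := exists_isHermite hdet
  exact ⟨C, (mem_R0_union_R1_iff hn hp).2 ⟨hC, (UnimodularEquiv.mul_left hU).symm.trans hM⟩,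
    mem_rightCoset_toQ.2 ⟨U, hU, rfl⟩⟩

theorem statement0 (n p : ℕ) (hn : 2 ≤ n) (hp : p.Prime) :
    (doubleCoset n (toQ n (Dmat n p)) = ⋃ C ∈ R0 n p ∪ R1 n p, rightCoset n (toQ n C)) ∧
    (∀ m ∈ doubleCoset n (toQ n (Dmat n p)),
      ∃! C : Matrix (Fin n) (Fin n) ℤ, C ∈ R0 n p ∪ R1 n p ∧ m ∈ rightCoset n (toQ n C)) ∧
    Disjoint (R0 n p) (R1 n p) ∧
    (∀ C ∈ R0 n p ∪ R1 n p, ∀ C' ∈ R0 n p ∪ R1 n p,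
      rightCoset n (toQ n C) = rightCoset n (toQ n C') → C = C') := by
  refine ⟨?_, fun m hm => ?_, disjoint_R0_R1 hp, fun C hC C' hC' h => ?_⟩
  · ext m
    simp only [Set.mem_iUnion, exists_prop]
    refine ⟨exists_mem_rightCoset hn hp, ?_⟩
    rintro ⟨C, hC, hm⟩
    obtain ⟨U, hU, rfl⟩ := mem_rightCoset_toQ.1 hm
    exact mem_doubleCoset_toQ.2 ⟨_, (UnimodularEquiv.mul_left hU).trans
      ((mem_R0_union_R1_iff hn hp).1 hC).2, rfl⟩
  · obtain ⟨C, hC, hmC⟩ := exists_mem_rightCoset hn hp hm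
    exact ⟨C, ⟨hC, hmC⟩, fun C' h => ((mem_R0_union_R1_iff hn hp).1 h.1).1.eq_of_mem_rightCoset
      ((mem_R0_union_R1_iff hn hp).1 hC).1 h.2 hmC⟩
  · exact ((mem_R0_union_R1_iff hn hp).1 hC).1.eq_of_mem_rightCoset
      ((mem_R0_union_R1_iff hn hp).1 hC').1 (self_mem_rightCoset C) (h ▸ self_mem_rightCoset C)
end

section
/- Let n ≥ 2 be an integer and p a prime. The cardinality of R₀^(n)(p) equals ((n−1)·p^n − n·p^{n−1} + 1)/(p−1). -/
open Matrix

/-- The gcd of the minors indexed by increasing maps divides every minor. -/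
theorem detDiv_dvd_det_submatrix {n k : ℕ} (C : Matrix (Fin n) (Fin n) ℤ) (f g : Fin k → Fin n) :
    detDiv n k C ∣ (C.submatrix f g).det := by
  by_cases hf : Function.Injective f
  swap
  · obtain ⟨a, b, hab, hne⟩ := Function.not_injective_iff.mp hf
    rw [Matrix.det_zero_of_row_eq hne (by ext j; simp [hab])]
    exact dvd_zero _
  by_cases hg : Function.Injective g
  swap
  · obtain ⟨a, b, hab, hne⟩ := Function.not_injective_iff.mp hg
    rw [Matrix.det_zero_of_column_eq hne (by intro j; simp [hab])]
    exact dvd_zero _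
  have hf' : StrictMono (f ∘ Tuple.sort f) :=
    (Tuple.monotone_sort f).strictMono_of_injective (hf.comp (Equiv.injective _))
  have hg' : StrictMono (g ∘ Tuple.sort g) :=
    (Tuple.monotone_sort g).strictMono_of_injective (hg.comp (Equiv.injective _))
  have key : detDiv n k C ∣ (C.submatrix (f ∘ Tuple.sort f) (g ∘ Tuple.sort g)).det :=
    Finset.gcd_dvd (f := fun fg : (Fin k → Fin n) × (Fin k → Fin n) =>
      (C.submatrix fg.1 fg.2).det) (b := (f ∘ Tuple.sort f, g ∘ Tuple.sort g))
      (by simpa using ⟨fun a b h => hf' h, fun a b h => hg' h⟩)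
  have e : C.submatrix f g = ((C.submatrix (f ∘ Tuple.sort f) (g ∘ Tuple.sort g)).submatrix
      ⇑(Tuple.sort f)⁻¹ id).submatrix id ⇑(Tuple.sort g)⁻¹ := by
    ext i j
    simp
  rw [e, Matrix.det_permute', Matrix.det_permute]
  exact (key.mul_left _).mul_left _

/-- The determinantal divisors divide minors indexed by any finite type of the right size. -/
theorem detDiv_dvd_det_submatrix_of_card {n k : ℕ} {ι : Type*} [Fintype ι] [DecidableEq ι]
    (hι : Fintype.card ι = k) (C : Matrix (Fin n) (Fin n) ℤ) (f g : ι → Fin n) :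
    detDiv n k C ∣ (C.submatrix f g).det := by
  let e : Fin k ≃ ι := (Fintype.equivFinOfCardEq hι).symm
  have h := detDiv_dvd_det_submatrix C (f ∘ e) (g ∘ e)
  rwa [← Matrix.submatrix_submatrix, Matrix.det_submatrix_equiv_self] at h

theorem dvd_detDiv {n k : ℕ} {C : Matrix (Fin n) (Fin n) ℤ} {d : ℤ}
    (h : ∀ f g : Fin k → Fin n, StrictMono f → StrictMono g → d ∣ (C.submatrix f g).det) :
    d ∣ detDiv n k C := by
  refine Finset.dvd_gcd fun fg hfg => ?_
  simp only [Finset.mem_filter, Finset.mem_univ, true_and] at hfg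
  exact h _ _ (fun a b => hfg.1 a b) (fun a b => hfg.2 a b)

theorem detDiv_eq_of_dvd_dvd {n k : ℕ} {C : Matrix (Fin n) (Fin n) ℤ} {d : ℤ} (hd : 0 ≤ d)
    (h₁ : detDiv n k C ∣ d) (h₂ : d ∣ detDiv n k C) : detDiv n k C = d :=
  Int.dvd_antisymm (Int.nonneg_of_normalize_eq_self Finset.normalize_gcd) hd h₁ h₂

/-- A matrix of rank at most one modulo `p` has determinant divisible by `p ^ (k - 1)`. -/
theorem pow_dvd_det_of_dvd_sub_mul {k : ℕ} {p : ℤ} (hp : p ≠ 0) (hk : 1 ≤ k)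
    (M : Matrix (Fin k) (Fin k) ℤ) (u v : Fin k → ℤ) (h : ∀ i j, p ∣ M i j - u i * v j) :
    p ^ (k - 1) ∣ M.det := by
  choose E hE using h
  let B (x y : ℤ) (D : Matrix (Fin k) (Fin k) ℤ) : Matrix (Unit ⊕ Fin k) (Unit ⊕ Fin k) ℤ :=
    Matrix.fromBlocks (Matrix.of fun _ _ => x) (Matrix.of fun _ j => -(y * v j))
      (Matrix.of fun i _ => u i) D
  have h₁ : M.det = (B 1 1 (p • Matrix.of E)).det := by
    have : (Matrix.of fun _ _ => (1 : ℤ) : Matrix Unit Unit ℤ) = 1 := by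
      ext i j; simp
    simp only [B, this]
    rw [Matrix.det_fromBlocks_one₁₁]
    congr 1
    ext i j
    simp [Matrix.mul_apply, ← hE]
  have h₂ : p * (B 1 1 (p • Matrix.of E)).det = (B p p (p • Matrix.of E)).det := by
    have := Matrix.det_mul_column (Sum.elim (fun _ => p) (fun _ => 1)) (B 1 1 (p • Matrix.of E))
    simp only [Fintype.prod_sum_type, Sum.elim_inl, Sum.elim_inr, Finset.univ_unique,
      Finset.prod_const, Finset.card_singleton, pow_one, one_pow, mul_one] at this
    rw [← this]
    congr 1
    ext i j
    rcases i with i | i <;> rcases j with j | j <;> simp [B]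
  have h₃ : (B p p (p • Matrix.of E)).det = p ^ k * (B p 1 (Matrix.of E)).det := by
    have := Matrix.det_mul_row (Sum.elim (fun _ => 1) (fun _ => p)) (B p 1 (Matrix.of E))
    simp only [Fintype.prod_sum_type, Sum.elim_inl, Sum.elim_inr, Finset.univ_unique,
      Finset.prod_const, Finset.card_univ, Fintype.card_fin, one_pow, one_mul] at this
    rw [← this]
    congr 1
    ext i j
    rcases i with i | i <;> rcases j with j | j <;> simp [B]
  rw [← h₁, h₃] at h₂
  obtain ⟨m, rfl⟩ : ∃ m, k = m + 1 := ⟨k - 1, by omega⟩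
  refine ⟨(B p 1 (Matrix.of E)).det, mul_left_cancel₀ hp ?_⟩
  rw [h₂, Nat.add_sub_cancel]
  ring

section Triangular

variable {n : ℕ} {p : ℤ} {C : Matrix (Fin n) (Fin n) ℤ}

theorem detDiv_dvd_pow (hC : ∀ i j, j < i → C i j = 0) (hd : ∀ i, C i i = p) {k : ℕ}
    (hk : k ≤ n) : detDiv n k C ∣ p ^ k := by
  have h := detDiv_dvd_det_submatrix C (Fin.castLE hk) (Fin.castLE hk)
  rw [Matrix.det_of_isUpperTriangular] at h
  swap
  · intro i j hij
    exact hC _ _ (by simpa using hij)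
  simpa [hd] using h

theorem detDiv_self_s1 (hp : 0 ≤ p) (hC : ∀ i j, j < i → C i j = 0) (hd : ∀ i, C i i = p) :
    detDiv n n C = p ^ n := by
  refine detDiv_eq_of_dvd_dvd (by positivity) (detDiv_dvd_pow hC hd le_rfl)
    (dvd_detDiv fun f g hf hg => ?_)
  have eq_id : ∀ f : Fin n → Fin n, StrictMono f → f = id := fun f hf =>
    (StrictMono.range_inj hf strictMono_id).mp (by
      rw [Set.range_id, (Finite.surjective_of_injective hf.injective).range_eq])
  rw [eq_id f hf, eq_id g hg, Matrix.submatrix_id_id,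
    Matrix.det_of_isUpperTriangular (M := C) (fun i j hij => hC _ _ hij)]
  simp [hd]

/-- An entry above the diagonal with only zeros between it and the diagonal
contributes its product with `p ^ (k - 1)` to the `k × k` minors. -/
theorem detDiv_dvd_mul_pow (hC : ∀ i j, j < i → C i j = 0) (hd : ∀ i, C i i = p) {k : ℕ}
    (hk : 1 ≤ k) (hkn : k ≤ n - 1) {a b : Fin n} (hab : a < b)
    (h0 : ∀ s, a < s → s ≠ b → C s b = 0) : detDiv n k C ∣ C a b * p ^ (k - 1) := by
  obtain ⟨T, haT, hTb, hT⟩ : ∃ T : Finset (Fin n), {a} ⊆ T ∧ T ⊆ Finset.univ.erase b ∧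
      T.card = k :=
    Finset.exists_subsuperset_card_eq (by simp [hab.ne]) (by simpa) (by simpa)
  let a' : T := ⟨a, haT (by simp)⟩
  have h := detDiv_dvd_det_submatrix_of_card (ι := T) (by simpa using hT) C
    (fun t => t) (fun t => if t = a' then b else t)
  rw [Matrix.det_of_isUpperTriangular] at h
  · rw [← Finset.mul_prod_erase _ _ (Finset.mem_univ a'),
      Finset.prod_congr rfl (g := fun _ => p)] at h
    · simpa [Finset.card_erase_of_mem, hT, a'] using h
    · intro t ht
      simp [Finset.ne_of_mem_erase ht, hd]
  · intro s t hts
    have hts' : t < s := hts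
    by_cases ht : t = a'
    · subst ht
      simp only [Matrix.submatrix_apply, if_true]
      exact h0 _ hts' (Finset.ne_of_mem_erase (hTb s.2))
    · simp only [Matrix.submatrix_apply, if_neg ht]
      exact hC _ _ hts'

end Triangular

section Count

variable {n p : ℕ}

/-- The matrix with `p` on the diagonal and least nonnegative residues elsewhere. -/
def residueLift (p : ℕ) {n : ℕ} (N : Matrix (Fin n) (Fin n) (ZMod p)) :
    Matrix (Fin n) (Fin n) ℤ :=
  Matrix.of fun i j => if i = j then (p : ℤ) else ((N i j).val : ℤ)

/-- Vectors with last nonzero entry equal to `1` in position `a`. -/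
def leftVectors (p : ℕ) [NeZero p] {n : ℕ} (a : Fin n) : Finset (Fin n → ZMod p) :=
  Fintype.piFinset fun k => if k < a then Finset.univ else if k = a then {1} else {0}

/-- Nonzero vectors supported strictly after `a`. -/
def rightVectors (p : ℕ) [NeZero p] {n : ℕ} (a : Fin n) : Finset (Fin n → ZMod p) :=
  (Fintype.piFinset fun k => if a < k then Finset.univ else {0}).erase 0

/-- Normalised factorisations of strictly upper triangular rank one matrices. -/
def rankOneData (p : ℕ) [NeZero p] (n : ℕ) :
    Finset (Σ _ : Fin n, (Fin n → ZMod p) × (Fin n → ZMod p)) :=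
  Finset.univ.sigma fun a => leftVectors p a ×ˢ rightVectors p a

theorem mem_leftVectors [NeZero p] {a : Fin n} {u : Fin n → ZMod p} :
    u ∈ leftVectors p a ↔ u a = 1 ∧ ∀ k, a < k → u k = 0 := by
  rw [leftVectors, Fintype.mem_piFinset]
  constructor
  · intro h
    refine ⟨by simpa using h a, fun k hk => ?_⟩
    simpa [hk.not_gt, hk.ne'] using h k
  · rintro ⟨h₁, h₂⟩ k
    rcases lt_trichotomy k a with hk | rfl | hk
    · simp [hk]
    · simp [h₁]
    · simp [hk.not_gt, hk.ne', h₂ k hk]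

theorem mem_rightVectors [NeZero p] {a : Fin n} {v : Fin n → ZMod p} :
    v ∈ rightVectors p a ↔ v ≠ 0 ∧ ∀ k, k ≤ a → v k = 0 := by
  rw [rightVectors, Finset.mem_erase, Fintype.mem_piFinset]
  refine and_congr_right fun _ => forall_congr' fun k => ?_
  by_cases hk : a < k
  · simp [hk, hk.not_ge]
  · simp [hk, not_lt.mp hk]

theorem card_leftVectors [NeZero p] (a : Fin n) : (leftVectors p a).card = p ^ (a : ℕ) := by
  have h : ∀ k : Fin n, (if k < a then (Finset.univ : Finset (ZMod p)) else
      if k = a then {1} else {0}).card = if k < a then p else 1 := by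
    intro k
    split_ifs <;> simp [ZMod.card]
  rw [leftVectors, Fintype.card_piFinset, Finset.prod_congr rfl fun k _ => h k,
    Finset.prod_ite]
  have : (Finset.univ.filter fun k => k < a) = Finset.Iio a := by ext; simp
  simp [this]

theorem card_rightVectors [NeZero p] (a : Fin n) :
    (rightVectors p a).card = p ^ (n - 1 - (a : ℕ)) - 1 := by
  have h : ∀ k : Fin n, (if a < k then (Finset.univ : Finset (ZMod p)) else {0}).card =
      if a < k then p else 1 := by
    intro k
    split_ifs <;> simp [ZMod.card]
  rw [rightVectors, Finset.card_erase_of_mem, Fintype.card_piFinset,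
    Finset.prod_congr rfl fun k _ => h k, Finset.prod_ite]
  · have : (Finset.univ.filter fun k => a < k) = Finset.Ioi a := by ext; simp
    simp [this]
  · rw [Fintype.mem_piFinset]
    intro k
    split_ifs <;> simp

theorem card_rankOneData [NeZero p] : (rankOneData p n).card =
    ∑ a ∈ Finset.range n, p ^ a * (p ^ (n - 1 - a) - 1) := by
  rw [rankOneData, Finset.card_sigma, Finset.sum_range]
  simp [Finset.card_product, card_leftVectors, card_rightVectors]

theorem vecMulVec_eq_zero [NeZero p] {a : Fin n} {u v : Fin n → ZMod p}
    (hu : u ∈ leftVectors p a) (hv : v ∈ rightVectors p a) {i j : Fin n} (hij : j ≤ i) :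
    u i * v j = 0 := by
  rcases le_or_gt i a with h | h
  · rw [(mem_rightVectors.mp hv).2 j (hij.trans h), mul_zero]
  · rw [(mem_leftVectors.mp hu).2 i h, zero_mul]

theorem residueLift_vecMulVec_mem_R0 (hp : p.Prime) [NeZero p] {a : Fin n} {u v : Fin n → ZMod p}
    (hu : u ∈ leftVectors p a) (hv : v ∈ rightVectors p a) :
    residueLift p (Matrix.vecMulVec u v) ∈ R0 n p := by
  set C := residueLift p (Matrix.vecMulVec u v) with hCdef
  have hp0 : (p : ℤ) ≠ 0 := by exact_mod_cast hp.ne_zero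
  have hoff : ∀ i j, i ≠ j → C i j = ((u i * v j).val : ℤ) := fun i j h => by
    simp [hCdef, residueLift, h, Matrix.vecMulVec_apply]
  have hd : ∀ i, C i i = (p : ℤ) := fun i => by simp [hCdef, residueLift]
  have hC : ∀ i j, j < i → C i j = 0 := fun i j h => by
    simp [hoff i j h.ne', vecMulVec_eq_zero hu hv h.le]
  have hmod : ∀ i j, (p : ℤ) ∣ C i j - (u i).val * (v j).val := by
    intro i j
    rw [← ZMod.intCast_zmod_eq_zero_iff_dvd]
    by_cases h : i = j
    · subst h
      simp [hd, vecMulVec_eq_zero hu hv le_rfl]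
    · simp [hoff i j h]
  obtain ⟨b, hb⟩ := Function.ne_iff.mp (mem_rightVectors.mp hv).1
  have hab : a < b := not_le.mp fun h => hb ((mem_rightVectors.mp hv).2 b h)
  refine ⟨hC, fun k hk hkn => ?_, detDiv_self_s1 (by positivity) hC hd, hd, fun i j h => ?_⟩
  · refine detDiv_eq_of_dvd_dvd (by positivity) ?_ (dvd_detDiv fun f g _ _ =>
      pow_dvd_det_of_dvd_sub_mul hp0 hk _ (fun i => ((u (f i)).val : ℤ))
        (fun j => ((v (g j)).val : ℤ)) fun i j => hmod _ _)
    have h₁ := detDiv_dvd_mul_pow hC hd hk hkn hab fun s hs hsb => by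
      simp [hoff s b hsb, (mem_leftVectors.mp hu).2 s hs]
    have h₂ := detDiv_dvd_pow hC hd (show k ≤ n by omega)
    rw [show (p : ℤ) ^ k = p * p ^ (k - 1) by rw [← pow_succ']; congr 1; omega] at h₂
    have hcop : IsCoprime (C a b) (p : ℤ) := by
      rw [hoff a b hab.ne, (mem_leftVectors.mp hu).1, one_mul, Nat.isCoprime_iff_coprime]
      refine (Nat.coprime_of_lt_prime ?_ (ZMod.val_lt _) hp).symm
      simpa using hb
    obtain ⟨x, y, hxy⟩ := hcop
    have := dvd_add (h₁.mul_left x) (h₂.mul_left y)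
    rwa [← mul_assoc, ← mul_assoc, ← add_mul, hxy, one_mul] at this
  · rw [hoff i j h.ne]
    exact ⟨by positivity, by exact_mod_cast ZMod.val_lt _⟩

theorem residueLift_injOn (hp : p.Prime) [NeZero p] :
    Set.InjOn (fun x : Σ _ : Fin n, (Fin n → ZMod p) × (Fin n → ZMod p) =>
      residueLift p (Matrix.vecMulVec x.2.1 x.2.2)) (rankOneData p n) := by
  have := Fact.mk hp
  rintro ⟨a, u, v⟩ hx ⟨a', u', v'⟩ hx' h
  simp only [rankOneData, Finset.coe_sigma, Set.mem_sigma_iff, Finset.mem_coe, Finset.mem_univ,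
    Finset.mem_product, true_and] at hx hx'
  have key : ∀ i j, u i * v j = u' i * v' j := by
    intro i j
    by_cases hij : i = j
    · subst hij
      rw [vecMulVec_eq_zero hx.1 hx.2 le_rfl, vecMulVec_eq_zero hx'.1 hx'.2 le_rfl]
    · have := congrFun (congrFun h i) j
      simp only [residueLift, Matrix.of_apply, if_neg hij, Matrix.vecMulVec_apply,
        Nat.cast_inj] at this
      exact ZMod.val_injective p this
  obtain ⟨hu, hu0⟩ := mem_leftVectors.mp hx.1
  obtain ⟨hu', hu0'⟩ := mem_leftVectors.mp hx'.1
  have hv := (mem_rightVectors.mp hx.2).1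
  have hv' := (mem_rightVectors.mp hx'.2).1
  have haa : a = a' := by
    rcases lt_trichotomy a a' with hlt | heq | hlt
    · exact absurd (funext fun j => by simpa [hu0 a' hlt, hu'] using (key a' j).symm) hv'
    · exact heq
    · exact absurd (funext fun j => by simpa [hu0' a hlt, hu] using key a j) hv
  subst haa
  have hvv : v = v' := funext fun j => by simpa [hu, hu'] using key a j
  subst hvv
  obtain ⟨b, hb⟩ := Function.ne_iff.mp hv
  have huu : u = u' := funext fun i => mul_right_cancel₀ hb (key i b)
  rw [huu]

/-- All `2 × 2` minors of an element of `R0` vanish modulo `p`. -/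
theorem R0_cast_mul_comm {C : Matrix (Fin n) (Fin n) ℤ} (hC : C ∈ R0 n p) (i j k l : Fin n) :
    (C i j * C k l : ZMod p) = C i l * C k j := by
  obtain ⟨h0, hdiv, -, hd, -⟩ := hC
  rcases Nat.lt_or_ge 2 n with hn | hn
  · have h := detDiv_dvd_det_submatrix C ![i, k] ![j, l]
    rw [hdiv 2 (by omega) (by omega), Matrix.det_fin_two] at h
    simp only [Nat.add_one_sub_one, pow_one] at h
    rw [← ZMod.intCast_zmod_eq_zero_iff_dvd] at h
    simpa [sub_eq_zero] using h
  · have hz : ∀ i j : Fin n, ¬ ((i : ℕ) = 0 ∧ (j : ℕ) = 1) → (C i j : ZMod p) = 0 := by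
      intro i j hij
      rcases lt_trichotomy i j with h | h | h
      · have := j.isLt
        have : (i : ℕ) < j := h
        omega
      · subst h; simp [hd]
      · simp [h0 i j h]
    by_cases hik : i = k
    · subst hik; ring
    by_cases hjl : j = l
    · subst hjl; ring
    have hik' : (i : ℕ) ≠ k := fun h => hik (Fin.ext h)
    have e₁ : (C i j * C k l : ZMod p) = 0 := by
      by_cases h : (i : ℕ) = 0 ∧ (j : ℕ) = 1
      · rw [hz k l (by omega), mul_zero]
      · rw [hz i j h, zero_mul]
    have e₂ : (C i l * C k j : ZMod p) = 0 := by
      by_cases h : (i : ℕ) = 0 ∧ (l : ℕ) = 1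
      · rw [hz k j (by omega), mul_zero]
      · rw [hz i l h, zero_mul]
    rw [e₁, e₂]

theorem R0_exists_cast_ne_zero (hn : 2 ≤ n) (hp : p.Prime) {C : Matrix (Fin n) (Fin n) ℤ}
    (hC : C ∈ R0 n p) : ∃ i j, (C i j : ZMod p) ≠ 0 := by
  by_contra! h
  have h₁ : (p : ℤ) ∣ detDiv n 1 C := dvd_detDiv fun f g _ _ => by
    rw [Matrix.det_unique, Matrix.submatrix_apply, ← ZMod.intCast_zmod_eq_zero_iff_dvd]
    exact h _ _
  rw [hC.2.1 1 le_rfl (by omega), Nat.sub_self, pow_zero] at h₁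
  exact hp.one_lt.ne' (by exact_mod_cast Int.eq_one_of_dvd_one (by positivity) h₁)

theorem exists_rankOneData_of_mem_R0 (hn : 2 ≤ n) (hp : p.Prime) [NeZero p]
    {C : Matrix (Fin n) (Fin n) ℤ} (hC : C ∈ R0 n p) :
    ∃ a : Fin n, ∃ u ∈ leftVectors p a, ∃ v ∈ rightVectors p a,
      residueLift p (Matrix.vecMulVec u v) = C := by
  have := Fact.mk hp
  obtain ⟨i₀, j₀, h₀⟩ := R0_exists_cast_ne_zero hn hp hC
  obtain ⟨a, ⟨b, hb⟩, hmax⟩ : ∃ a : Fin n, (∃ b, (C a b : ZMod p) ≠ 0) ∧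
      ∀ k, a < k → ∀ j, (C k j : ZMod p) = 0 := by
    obtain ⟨a, ha⟩ := (Set.toFinite {a : Fin n | ∃ b, (C a b : ZMod p) ≠ 0}).exists_maximal
      ⟨i₀, j₀, h₀⟩
    refine ⟨a, ha.1, fun k hk j => ?_⟩
    by_contra hne
    exact ha.not_gt ⟨j, hne⟩ hk
  have hminor := R0_cast_mul_comm hC
  obtain ⟨h0, -, -, hd, hrange⟩ := hC
  refine ⟨a, fun i => C i b / C a b, ?_, fun j => C a j, ?_, ?_⟩
  · rw [mem_leftVectors]
    exact ⟨div_self hb, fun k hk => by simp [hmax k hk]⟩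
  · rw [mem_rightVectors]
    refine ⟨Function.ne_iff.mpr ⟨b, hb⟩, fun k hk => ?_⟩
    rcases hk.eq_or_lt with rfl | hk
    · simp [hd]
    · simp [h0 a k hk]
  · ext i j
    by_cases hij : i = j
    · subst hij; simp [residueLift, hd]
    · have e : (C i b / C a b * C a j : ZMod p) = C i j := by
        field_simp
        linear_combination hminor i b a j
      simp only [residueLift, Matrix.of_apply, if_neg hij, Matrix.vecMulVec_apply, e]
      rw [ZMod.val_intCast]
      rcases lt_or_gt_of_ne hij with h | h
      · exact Int.emod_eq_of_lt (hrange i j h).1 (hrange i j h).2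
      · simp [h0 i j h]

theorem ncard_R0 (hn : 2 ≤ n) (hp : p.Prime) :
    (R0 n p).ncard = ∑ a ∈ Finset.range n, p ^ a * (p ^ (n - 1 - a) - 1) := by
  have : NeZero p := ⟨hp.ne_zero⟩
  rw [← card_rankOneData, ← Set.ncard_coe_finset, ← (residueLift_injOn hp).ncard_image]
  congr 1
  ext C
  constructor
  · intro hC
    obtain ⟨a, u, hu, v, hv, h⟩ := exists_rankOneData_of_mem_R0 hn hp hC
    exact ⟨⟨a, u, v⟩, by simp [rankOneData, hu, hv], h⟩
  · rintro ⟨⟨a, u, v⟩, hx, rfl⟩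
    simp only [rankOneData, Finset.coe_sigma, Set.mem_sigma_iff, Finset.mem_coe, Finset.mem_univ,
      Finset.mem_product, true_and] at hx
    exact residueLift_vecMulVec_mem_R0 hp hx.1 hx.2

end Count

theorem statement1 (n p : ℕ) (hn : 2 ≤ n) (hp : p.Prime) :
    ((R0 n p).ncard : ℚ) =
      (((n : ℚ) - 1) * (p : ℚ) ^ n - (n : ℚ) * (p : ℚ) ^ (n - 1) + 1) / ((p : ℚ) - 1) := by
  have hp1 : (p : ℚ) ≠ 1 := by exact_mod_cast hp.one_lt.ne'
  have hsum : ((R0 n p).ncard : ℚ) =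
      ∑ a ∈ Finset.range n, ((p : ℚ) ^ (n - 1) - (p : ℚ) ^ a) := by
    rw [ncard_R0 hn hp, Nat.cast_sum]
    refine Finset.sum_congr rfl fun a ha => ?_
    have ha' := Finset.mem_range.mp ha
    rw [Nat.cast_mul, Nat.cast_sub (Nat.one_le_pow _ _ hp.pos)]
    push_cast
    rw [mul_sub, ← pow_add, mul_one, show a + (n - 1 - a) = n - 1 by omega]
  rw [hsum, Finset.sum_sub_distrib, geom_sum_eq hp1, Finset.sum_const, Finset.card_range,
    nsmul_eq_mul, eq_div_iff (sub_ne_zero.mpr hp1), sub_mul, div_mul_cancel₀ _ (sub_ne_zero.mpr hp1)]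
  obtain ⟨m, rfl⟩ : ∃ m, n = m + 1 := ⟨n - 1, by omega⟩
  rw [Nat.add_sub_cancel]
  push_cast
  ring
end

section
/- Let n ≥ 2 be an integer and p a prime. The cardinality of R₁^(n)(p) equals (p^{2n} − n·p^{n+1} + 2(n−1)·p^n − n·p^{n−1} + 1)/(p−1)². -/
open Matrix

/-- The diagonal with entry `1` at `a`, entry `p²` at `b` and entry `p` elsewhere. -/
def diagEntry {n : ℕ} (p : ℕ) (a b j : Fin n) : ℤ :=
  if j = a then 1 else if j = b then (p : ℤ) ^ 2 else (p : ℤ)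

/-- The admissible values of the `(i, j)` entry of a member of `R1 n p` with diagonal
`diagEntry p a b`. -/
noncomputable def entrySet {n : ℕ} (p : ℕ) (a b i j : Fin n) : Finset ℤ :=
  if j < i then {0}
  else if i = j then {diagEntry p a b j}
  else if i = a then Finset.Ico 0 (diagEntry p a b j)
  else (Finset.Ico 0 (diagEntry p a b j)).filter ((p : ℤ) ∣ ·)

/-- The members of `R1 n p` with diagonal `diagEntry p a b`. -/
noncomputable def matrixSet {n : ℕ} (p : ℕ) (a b : Fin n) : Finset (Matrix (Fin n) (Fin n) ℤ) :=
  (Fintype.piFinset fun i => Fintype.piFinset fun j => entrySet p a b i j).map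
    Matrix.of.toEmbedding

lemma card_filter_dvd_Ico_mul {p : ℕ} (hp : 0 < p) (k : ℕ) :
    ((Finset.Ico (0 : ℤ) (p * k)).filter ((p : ℤ) ∣ ·)).card = k := by
  have hp' : (0 : ℤ) < p := by exact_mod_cast hp
  have h : (Finset.Ico (0 : ℤ) (p * k)).filter ((p : ℤ) ∣ ·) =
      (Finset.Ico (0 : ℤ) k).image ((p : ℤ) * ·) := by
    ext x
    simp only [Finset.mem_filter, Finset.mem_Ico, Finset.mem_image]
    constructor
    · rintro ⟨⟨h0, h1⟩, y, rfl⟩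
      exact ⟨y, ⟨by nlinarith, lt_of_mul_lt_mul_left h1 hp'.le⟩, rfl⟩
    · rintro ⟨y, ⟨h0, h1⟩, rfl⟩
      exact ⟨⟨by positivity, mul_lt_mul_of_pos_left h1 hp'⟩, dvd_mul_right _ _⟩
  rw [h, Finset.card_image_of_injective _ (mul_right_injective₀ hp'.ne')]
  simp

lemma filter_dvd_Ico_one (p : ℕ) :
    (Finset.Ico (0 : ℤ) 1).filter ((p : ℤ) ∣ ·) = {0} := by
  ext x
  simp only [Finset.mem_filter, Finset.mem_Ico, Finset.mem_singleton]
  constructor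
  · rintro ⟨⟨h0, h1⟩, -⟩
    omega
  · rintro rfl
    simp

lemma card_entrySet {n p : ℕ} (hp : 0 < p) {a b : Fin n} (hab : a ≠ b) (i j : Fin n) :
    (entrySet p a b i j).card =
      (if i = a ∧ a < j then p else 1) * (if j = b ∧ i < b then p else 1) := by
  have hsq := card_filter_dvd_Ico_mul hp p
  have hone := card_filter_dvd_Ico_mul hp 1
  rw [← sq] at hsq
  rw [Nat.cast_one, mul_one] at hone
  rcases lt_trichotomy j i with hji | rfl | hij
  · have h1 : ¬ (i = a ∧ a < j) := by omega
    have h2 : ¬ (j = b ∧ i < b) := by omega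
    simp [entrySet, hji, h1, h2]
  · have h1 : ¬ (j = a ∧ a < j) := by omega
    have h2 : ¬ (j = b ∧ j < b) := by omega
    simp [entrySet, h1, h2]
  rw [entrySet, if_neg hij.not_gt, if_neg hij.ne, diagEntry]
  by_cases hia : i = a
  · subst hia
    by_cases hjb : j = b
    · subst hjb
      have h : ((p : ℤ) ^ 2).toNat = p * p := by
        rw [← Nat.cast_pow, Int.toNat_natCast, sq]
      simp [hij, hij.ne', h]
    · simp [hij, hij.ne', hjb]
  · by_cases hja : j = a
    · subst hja
      simp [hia, hab, filter_dvd_Ico_one]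
    · by_cases hjb : j = b
      · subst hjb
        simp [hia, hja, hij, hsq]
      · simp [hia, hja, hjb, hone]

lemma card_matrixSet {n p : ℕ} (hp : 0 < p) {a b : Fin n} (hab : a ≠ b) :
    (matrixSet p a b).card = p ^ (n - 1 - (a : ℕ)) * p ^ (b : ℕ) := by
  have ha : ∏ i : Fin n, ∏ j : Fin n, (if i = a ∧ a < j then p else 1) =
      p ^ (n - 1 - (a : ℕ)) := by
    simp only [ite_and]
    rw [Finset.prod_eq_single a (by intro i _ hi; simp [hi]) (by simp)]
    simp [Finset.prod_ite, Finset.filter_lt_eq_Ioi, Fin.card_Ioi]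
  have hb : ∏ i : Fin n, ∏ j : Fin n, (if j = b ∧ i < b then p else 1) = p ^ (b : ℕ) := by
    rw [Finset.prod_comm]
    simp only [ite_and]
    rw [Finset.prod_eq_single b (by intro i _ hi; simp [hi]) (by simp)]
    simp [Finset.prod_ite, Finset.filter_gt_eq_Iio, Fin.card_Iio]
  rw [matrixSet, Finset.card_map, Fintype.card_piFinset, ← ha, ← hb, ← Finset.prod_mul_distrib]
  refine Finset.prod_congr rfl fun i _ => ?_
  rw [Fintype.card_piFinset, ← Finset.prod_mul_distrib]
  exact Finset.prod_congr rfl fun j _ => card_entrySet hp hab i j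

lemma mem_matrixSet_iff {n p : ℕ} (hp : p.Prime) {a b : Fin n} (hab : a ≠ b)
    {C : Matrix (Fin n) (Fin n) ℤ} :
    C ∈ matrixSet p a b ↔ C ∈ R1 n p ∧ C a a = 1 ∧ C b b = (p : ℤ) ^ 2 := by
  have h1p : (1 : ℤ) < p := by exact_mod_cast hp.one_lt
  have hps : (p : ℤ) < (p : ℤ) ^ 2 := by nlinarith
  have hnd : ¬ (p : ℤ) ∣ 1 := fun h => by have := Int.le_of_dvd one_pos h; omega
  have hdvd (j : Fin n) (hj : j ≠ a) : (p : ℤ) ∣ diagEntry p a b j := by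
    rw [diagEntry, if_neg hj]
    split_ifs
    · exact dvd_pow_self _ two_ne_zero
    · exact dvd_rfl
  have hmem : C ∈ matrixSet p a b ↔ ∀ i j, C i j ∈ entrySet p a b i j := by
    simp only [matrixSet, Finset.mem_map_equiv, Fintype.mem_piFinset, Matrix.of_symm_apply]
  rw [hmem]
  constructor
  · intro h
    have hd (i : Fin n) : C i i = diagEntry p a b i := by simpa [entrySet] using h i i
    have haa : C a a = 1 := by simp [hd, diagEntry]
    have hbb : C b b = (p : ℤ) ^ 2 := by simp [hd, diagEntry, hab.symm]
    refine ⟨⟨fun i j hij => by simpa [entrySet, hij] using h i j, fun i => ?_,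
      ⟨a, haa, fun i hi => ?_⟩, ⟨b, hbb, fun i hi => ?_⟩, fun i j hij => ?_,
      fun i j hij hdi => ?_⟩, haa, hbb⟩
    · rw [hd, diagEntry]
      split_ifs <;> simp
    · simp only [hd, diagEntry] at hi
      split_ifs at hi <;> first | assumption | omega
    · simp only [hd, diagEntry] at hi
      split_ifs at hi <;> first | assumption | omega
    · have := h i j
      rw [entrySet, if_neg hij.not_gt, if_neg hij.ne] at this
      rw [hd]
      split_ifs at this
      · simpa using this
      · exact Finset.mem_Ico.1 (Finset.mem_filter.1 this).1
    · have hia : i ≠ a := by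
        rintro rfl
        exact hnd (haa ▸ hdi)
      have := h i j
      rw [entrySet, if_neg hij.not_gt, if_neg hij.ne, if_neg hia] at this
      exact (Finset.mem_filter.1 this).2
  · rintro ⟨⟨hlow, hdiag, ⟨a', ha', hau⟩, ⟨b', hb', hbu⟩, hbd, hdv⟩, haa, hbb⟩ i j
    have hd (i : Fin n) : C i i = diagEntry p a b i := by
      unfold diagEntry
      split_ifs with hia hib
      · rw [hia, haa]
      · rw [hib, hbb]
      · rcases hdiag i with h | h | h
        · exact absurd ((hau i h).trans (hau a haa).symm) hia
        · exact h
        · exact absurd ((hbu i h).trans (hbu b hbb).symm) hib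
    unfold entrySet
    split_ifs with hji hij hia
    · simpa using hlow i j hji
    · simpa [hij] using hd j
    · have := hbd i j (by omega)
      rwa [hd, ← Finset.mem_Ico] at this
    · have := hbd i j (by omega)
      rw [hd, ← Finset.mem_Ico] at this
      exact Finset.mem_filter.2 ⟨this, hdv i j (by omega) (hd i ▸ hdvd i hia)⟩

lemma R1_eq_biUnion {n p : ℕ} (hp : p.Prime) :
    R1 n p = ((Finset.univ : Finset (Fin n)).offDiag.biUnion fun x => matrixSet p x.1 x.2 :
      Finset (Matrix (Fin n) (Fin n) ℤ)) := by
  ext C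
  simp only [Finset.coe_biUnion, Set.mem_iUnion, Finset.mem_coe, Finset.mem_offDiag,
    Finset.mem_univ, true_and, exists_prop, Prod.exists]
  constructor
  · intro h
    obtain ⟨-, -, ⟨a, ha, -⟩, ⟨b, hb, -⟩, -⟩ := id h
    have hab : a ≠ b := by
      rintro rfl
      have h1p : (1 : ℤ) < p := by exact_mod_cast hp.one_lt
      have ha : C a a = 1 := ha
      have hb : C a a = (p : ℤ) ^ 2 := hb
      nlinarith
    exact ⟨a, b, hab, (mem_matrixSet_iff hp hab).2 ⟨h, ha, hb⟩⟩
  · rintro ⟨a, b, hab, h⟩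
    exact ((mem_matrixSet_iff hp hab).1 h).1

lemma ncard_R1 {n p : ℕ} (hp : p.Prime) :
    (R1 n p).ncard = ∑ x ∈ (Finset.univ : Finset (Fin n)).offDiag,
      p ^ (n - 1 - (x.1 : ℕ)) * p ^ (x.2 : ℕ) := by
  rw [R1_eq_biUnion hp, Set.ncard_coe_finset, Finset.card_biUnion]
  · refine Finset.sum_congr rfl fun x hx => card_matrixSet hp.pos ?_
    simpa using hx
  · rintro ⟨a, b⟩ hab ⟨a', b'⟩ hab' hne
    refine Finset.disjoint_left.2 fun C hC hC' => hne ?_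
    obtain ⟨⟨-, -, ha, hb, -⟩, ha1, hb1⟩ := (mem_matrixSet_iff hp (by simpa using hab)).1 hC
    obtain ⟨-, ha2, hb2⟩ := (mem_matrixSet_iff hp (by simpa using hab')).1 hC'
    exact Prod.ext (ha.unique ha1 ha2) (hb.unique hb1 hb2)

theorem statement2 (n p : ℕ) (hn : 2 ≤ n) (hp : p.Prime) :
    ((R1 n p).ncard : ℚ) =
      ((p : ℚ) ^ (2 * n) - (n : ℚ) * (p : ℚ) ^ (n + 1) + 2 * ((n : ℚ) - 1) * (p : ℚ) ^ n
          - (n : ℚ) * (p : ℚ) ^ (n - 1) + 1) / ((p : ℚ) - 1) ^ 2 := by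
  have hp1 : (p : ℚ) - 1 ≠ 0 := sub_ne_zero.2 (by exact_mod_cast hp.one_lt.ne')
  have hup : ∑ i : Fin n, (p : ℚ) ^ (i : ℕ) = ((p : ℚ) ^ n - 1) / ((p : ℚ) - 1) := by
    rw [Fin.sum_univ_eq_sum_range fun i => (p : ℚ) ^ i, geom_sum_eq (sub_ne_zero.1 hp1)]
  have hdown : ∑ i : Fin n, (p : ℚ) ^ (n - 1 - (i : ℕ)) = ((p : ℚ) ^ n - 1) / ((p : ℚ) - 1) := by
    rw [Fin.sum_univ_eq_sum_range fun i => (p : ℚ) ^ (n - 1 - i),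
      Finset.sum_range_reflect fun i => (p : ℚ) ^ i, geom_sum_eq (sub_ne_zero.1 hp1)]
  have hdiag : ∑ i : Fin n, (p : ℚ) ^ (n - 1 - (i : ℕ)) * (p : ℚ) ^ (i : ℕ) =
      n * (p : ℚ) ^ (n - 1) := by
    rw [Finset.sum_congr rfl fun i _ => by
      rw [← pow_add, Nat.sub_add_cancel (Nat.le_sub_one_of_lt i.isLt)]]
    simp
  have hall : ∑ x ∈ (Finset.univ : Finset (Fin n)).offDiag,
        (p : ℚ) ^ (n - 1 - (x.1 : ℕ)) * (p : ℚ) ^ (x.2 : ℕ) + n * (p : ℚ) ^ (n - 1) =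
      (((p : ℚ) ^ n - 1) / ((p : ℚ) - 1)) * (((p : ℚ) ^ n - 1) / ((p : ℚ) - 1)) := by
    nth_rewrite 1 [← hdown]
    rw [← hup, ← hdiag, Finset.sum_mul_sum, ← Finset.sum_product',
      ← Finset.diag_union_offDiag, Finset.sum_union (Finset.disjoint_diag_offDiag _),
      Finset.sum_diag, add_comm]
  rw [ncard_R1 hp]
  push_cast
  rw [eq_sub_of_add_eq hall]
  obtain ⟨m, rfl⟩ : ∃ m, n = m + 1 := ⟨n - 1, by omega⟩
  field_simp
  simp only [Nat.add_sub_cancel]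
  push_cast
  ring
end
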